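/- The subgroup H = C ⋉ K of Aut(C³), where C = {(αx, αy, αz) : α ∈ C*} and K = {exp(qD) : q ∈ p·C[pz²]}, consists exactly of those elements of the centralizer of exp(D) that commute with every element of the torus {(α³x, αy, α⁻¹z) : α ∈ C*}. -/

import Mathlib

open MvPolynomial

noncomputable section

/-- The polynomial ring ℂ[x,y,z], with x = X 0, y = X 1, z = X 2. -/
abbrev R3 : Type := MvPolynomial (Fin 3) ℂ

/-- The derivation D = z·∂/∂y + y·∂/∂x, i.e. D x = y, D y = z, D z = 0. -/
def D : Derivation ℂ R3 R3 := mkDerivation ℂ ![X 1, X 2, 0]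

/-- p = xz - (1/2)y² -/
def p : R3 := X 0 * X 2 - C (1/2) * X 1 ^ 2

/-- The exponential automorphism exp(qD) of ℂ³ (for q ∈ ker D), given by its
closed formula: since D q = 0, (qD)x = qy, (qD)²x = q²z, (qD)³x = 0, so
exp(qD) = (x + qy + q²z/2, y + qz, z). -/
def expMap (q : R3) : (Fin 3 → ℂ) → (Fin 3 → ℂ) :=
  fun a => ![a 0 + eval a q * a 1 + eval a q ^ 2 * a 2 / 2,
             a 1 + eval a q * a 2, a 2]

/-- A map ℂ³ → ℂ³ given coordinatewise by polynomials. -/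
def IsPolyMap (F : (Fin 3 → ℂ) → (Fin 3 → ℂ)) : Prop :=
  ∃ f : Fin 3 → R3, ∀ a i, F a i = eval a (f i)

/-- A polynomial automorphism of ℂ³: a polynomial map with a polynomial inverse. -/
def IsPolyAut (F : (Fin 3 → ℂ) → (Fin 3 → ℂ)) : Prop :=
  IsPolyMap F ∧ ∃ G, IsPolyMap G ∧ F ∘ G = id ∧ G ∘ F = id

/-- h' = exp(D) : (x,y,z) ↦ (x + y + z/2, y + z, z). -/
def h'map : (Fin 3 → ℂ) → (Fin 3 → ℂ) :=
  fun a => ![a 0 + a 1 + a 2 / 2, a 1 + a 2, a 2]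

/-- C = {(αx, αy, αz) : α ∈ ℂ*} -/
def Cset : Set ((Fin 3 → ℂ) → (Fin 3 → ℂ)) :=
  {F | ∃ α : ℂ, α ≠ 0 ∧ F = fun a => ![α * a 0, α * a 1, α * a 2]}

/-- K = {exp(qD) : q ∈ p·ℂ[pz²]} -/
def Kset : Set ((Fin 3 → ℂ) → (Fin 3 → ℂ)) :=
  {F | ∃ w : R3, w ∈ Algebra.adjoin ℂ ({p * X 2 ^ 2} : Set R3) ∧ F = expMap (p * w)}

namespace MvPolynomial

/-- Evaluating a one-variable substitution instance of a multivariate polynomial. -/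
theorem eval_aeval_polynomial {σ R : Type*} [CommRing R] (g : MvPolynomial σ R)
    (v : σ → Polynomial R) (t : R) :
    (aeval v g).eval t = eval (fun i => (v i).eval t) g := by
  induction g using MvPolynomial.induction_on with
  | C a => simp
  | add f g hf hg => simp [hf, hg]
  | mul_X f i hf => simp [hf]

/-- Polynomials over an infinite domain that agree off the zero set of a nonzero polynomial
are equal. -/
theorem funext_off_zeros {σ R : Type*} [CommRing R] [IsDomain R] [Infinite R]
    {f g h : MvPolynomial σ R} (hh : h ≠ 0)
    (H : ∀ a, eval a h ≠ 0 → eval a f = eval a g) : f = g := by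
  refine mul_left_cancel₀ hh (MvPolynomial.funext fun a => ?_)
  by_cases ha : eval a h = 0
  · simp [ha]
  · simp [H a ha]

end MvPolynomial

theorem IsPolyMap.comp {F G : (Fin 3 → ℂ) → (Fin 3 → ℂ)} (hF : IsPolyMap F)
    (hG : IsPolyMap G) : IsPolyMap (F ∘ G) := by
  obtain ⟨f, hf⟩ := hF
  obtain ⟨g, hg⟩ := hG
  refine ⟨fun i => bind₁ g (f i), fun a i => ?_⟩
  have : G a = fun j => eval a (g j) := funext (hg a)
  rw [Function.comp_apply, hf, this]
  simp only [← aeval_eq_eval, aeval_bind₁]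

theorem isPolyMap_expMap (q : R3) : IsPolyMap (expMap q) := by
  refine ⟨![X 0 + q * X 1 + C (1 / 2) * q ^ 2 * X 2, X 1 + q * X 2, X 2], fun a i => ?_⟩
  fin_cases i <;> simp [expMap]
  ring

theorem isPolyMap_smul (α : ℂ) :
    IsPolyMap fun a => ![α * a 0, α * a 1, α * a 2] := by
  refine ⟨fun i => C α * X i, fun a i => ?_⟩
  fin_cases i <;> simp

theorem eval_p (a : Fin 3 → ℂ) : eval a p = a 0 * a 2 - a 1 ^ 2 / 2 := by
  simp [p]
  ring

theorem eval_aeval_p_mul_sq (W : Polynomial ℂ) (a : Fin 3 → ℂ) :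
    eval a (Polynomial.aeval (p * X 2 ^ 2) W) =
      W.eval ((a 0 * a 2 - a 1 ^ 2 / 2) * a 2 ^ 2) := by
  have h := Polynomial.map_aeval_eq_aeval_map (S := R3) (T := ℂ) (U := ℂ) (φ := RingHom.id ℂ)
    (ψ := eval a) (by ext; simp) W (p * X 2 ^ 2)
  rw [h]
  simp [eval_p]

/-- The element `p * W(pz²)` of `p·ℂ[pz²]`. -/
def pMulPoly (W : Polynomial ℂ) : R3 := p * Polynomial.aeval (p * X 2 ^ 2) W

theorem eval_pMulPoly (W : Polynomial ℂ) (a : Fin 3 → ℂ) :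
    eval a (pMulPoly W) =
      (a 0 * a 2 - a 1 ^ 2 / 2) * W.eval ((a 0 * a 2 - a 1 ^ 2 / 2) * a 2 ^ 2) := by
  rw [pMulPoly, map_mul, eval_p, eval_aeval_p_mul_sq]

theorem eval_expMap_pMulPoly (q : R3) (W : Polynomial ℂ) (a : Fin 3 → ℂ) :
    eval (expMap q a) (pMulPoly W) = eval a (pMulPoly W) := by
  have h : expMap q a 0 * expMap q a 2 - expMap q a 1 ^ 2 / 2 = a 0 * a 2 - a 1 ^ 2 / 2 := by
    simp [expMap]
    ring
  rw [eval_pMulPoly, eval_pMulPoly, h]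
  rfl

theorem eval_h'map_pMulPoly (W : Polynomial ℂ) (a : Fin 3 → ℂ) :
    eval (h'map a) (pMulPoly W) = eval a (pMulPoly W) := by
  have h : h'map a = expMap 1 a := by
    ext i; fin_cases i <;> simp [h'map, expMap]
  rw [h, eval_expMap_pMulPoly]

theorem eval_torus_pMulPoly (W : Polynomial ℂ) {α : ℂ} (hα : α ≠ 0) (a : Fin 3 → ℂ) :
    eval ![α ^ 3 * a 0, α * a 1, α⁻¹ * a 2] (pMulPoly W) = α ^ 2 * eval a (pMulPoly W) := by
  have h : α ^ 3 * a 0 * (α⁻¹ * a 2) - (α * a 1) ^ 2 / 2 =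
      α ^ 2 * (a 0 * a 2 - a 1 ^ 2 / 2) := by
    field_simp
  have h' : α ^ 2 * (a 0 * a 2 - a 1 ^ 2 / 2) * (α⁻¹ * a 2) ^ 2 =
      (a 0 * a 2 - a 1 ^ 2 / 2) * a 2 ^ 2 := by
    field_simp
  rw [eval_pMulPoly, eval_pMulPoly]
  simp only [Matrix.cons_val]
  rw [h, h', mul_assoc]

theorem expMap_pMulPoly_neg (W : Polynomial ℂ) (a : Fin 3 → ℂ) :
    expMap (pMulPoly W) (expMap (pMulPoly (-W)) a) = a := by
  have h : eval a (pMulPoly (-W)) = -eval a (pMulPoly W) := by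
    simp [eval_pMulPoly]
  rw [expMap, eval_expMap_pMulPoly, expMap, h]
  ext i; fin_cases i <;> (simp; try ring)

/-- The points of the orbit of `a` under the one-parameter group `exp(tD)`. -/
def flow (t : ℂ) (a : Fin 3 → ℂ) : Fin 3 → ℂ :=
  ![a 0 + t * a 1 + t ^ 2 * a 2 / 2, a 1 + t * a 2, a 2]

/-- A polynomial invariant under `exp(D)` is invariant under `exp(tD)` for every `t`. -/
theorem eval_flow_of_invariant {g : R3} (hg : ∀ a, eval (h'map a) g = eval a g)
    (t : ℂ) (a : Fin 3 → ℂ) : eval (flow t a) g = eval a g := by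
  have hn : ∀ n : ℕ, eval (flow n a) g = eval a g := by
    intro n
    induction n with
    | zero =>
      congr 2
      ext i; fin_cases i <;> simp [flow]
    | succ n ih =>
      rw [← ih, ← hg (flow n a)]
      congr 2
      ext i; fin_cases i <;> simp [flow, h'map] <;> ring
  let v : Fin 3 → Polynomial ℂ :=
    ![.C (a 0) + .X * .C (a 1) + .X ^ 2 * .C (a 2 / 2), .C (a 1) + .X * .C (a 2), .C (a 2)]
  have hv : ∀ s : ℂ, (aeval v g).eval s = eval (flow s a) g := by
    intro s
    rw [eval_aeval_polynomial]
    congr 2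
    ext i; fin_cases i <;> simp [flow, v] <;> ring
  have hQ : aeval v g = Polynomial.C (eval a g) := by
    refine Polynomial.eq_of_infinite_eval_eq _ _ ?_
    refine Set.infinite_of_injective_forall_mem (f := fun n : ℕ => (n : ℂ))
      Nat.cast_injective fun n => ?_
    simp [hv, hn]
  rw [← hv, hQ, Polynomial.eval_C]

/-- The restriction of `g` to the line `y = 0`, `z = 1`. -/
def lineRestriction (g : R3) : Polynomial ℂ := aeval ![.X, 0, 1] g

/-- An `exp(D)`-invariant polynomial that is semi-invariant of weight `w` under the torus
is, up to a power of `z`, a polynomial in `pz²`. -/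
theorem zpow_mul_eval_eq {g : R3} (hg : ∀ a, eval (h'map a) g = eval a g) (w : ℤ)
    (hw : ∀ α : ℂ, α ≠ 0 → ∀ a : Fin 3 → ℂ,
      eval ![α ^ 3 * a 0, α * a 1, α⁻¹ * a 2] g = α ^ w * eval a g)
    (a : Fin 3 → ℂ) (ha : a 2 ≠ 0) :
    a 2 ^ w * eval a g =
      (lineRestriction g).eval ((a 0 * a 2 - a 1 ^ 2 / 2) * a 2 ^ 2) := by
  rw [← eval_flow_of_invariant hg (-a 1 / a 2) a, ← hw _ ha, lineRestriction,
    eval_aeval_polynomial]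
  congr 2
  ext i
  fin_cases i
  · simp [flow]
    field_simp
    ring
  · simp [flow, ha]
  · simp [flow, ha]

theorem isPolyAut_smul_comp_expMap {α : ℂ} (hα : α ≠ 0) (W : Polynomial ℂ) :
    IsPolyAut ((fun a => ![α * a 0, α * a 1, α * a 2]) ∘ expMap (pMulPoly W)) := by
  refine ⟨(isPolyMap_smul α).comp (isPolyMap_expMap _),
    expMap (pMulPoly (-W)) ∘ fun a => ![α⁻¹ * a 0, α⁻¹ * a 1, α⁻¹ * a 2],
    (isPolyMap_expMap _).comp (isPolyMap_smul _), funext fun a => ?_, funext fun a => ?_⟩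
  · simp only [Function.comp_apply, expMap_pMulPoly_neg]
    ext i; fin_cases i <;> simp [hα]
  · have h : (![α⁻¹ * (α * expMap (pMulPoly W) a 0), α⁻¹ * (α * expMap (pMulPoly W) a 1),
        α⁻¹ * (α * expMap (pMulPoly W) a 2)] : Fin 3 → ℂ) = expMap (pMulPoly W) a := by
      ext i; fin_cases i <;> simp [hα]
    have h' := expMap_pMulPoly_neg (-W) a
    rw [neg_neg] at h'
    simpa only [Function.comp_apply, Matrix.cons_val, h, id] using h'

theorem Polynomial.exists_eq_X_mul_of_eval_zero {R : Type*} [CommRing R] {U : Polynomial R}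
    (h : U.eval 0 = 0) : ∃ V, U = Polynomial.X * V :=
  Polynomial.X_dvd_iff.2 (by rwa [Polynomial.coeff_zero_eq_eval_zero])

theorem Polynomial.eq_zero_of_forall_add_mul_eval_ne_zero {k : Type*} [Field k] [IsAlgClosed k]
    {c : k} {S : Polynomial k} (h : ∀ x, c + x * S.eval x ≠ 0) : S = 0 := by
  have hdeg : (Polynomial.C c + Polynomial.X * S).degree = 0 := by
    by_contra hne
    obtain ⟨x, hx⟩ := IsAlgClosed.exists_root _ hne
    exact h x (by simpa using hx)
  ext n
  have := congrArg (fun Q => Q.coeff (n + 1)) (Polynomial.eq_C_of_degree_eq_zero hdeg)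
  simpa [Polynomial.coeff_C] using this

theorem X_two_ne_zero : (X 2 : R3) ≠ 0 := X_ne_zero 2

/-- The last coordinate of an automorphism in the centralizer is a multiple of `z`. -/
theorem exists_last_coordinate {F : (Fin 3 → ℂ) → (Fin 3 → ℂ)} (hF : IsPolyAut F)
    (hc : ∀ a, F (h'map a) = h'map (F a))
    (ht : ∀ α : ℂ, α ≠ 0 → ∀ a, F ![α ^ 3 * a 0, α * a 1, α⁻¹ * a 2] =
      ![α ^ 3 * F a 0, α * F a 1, α⁻¹ * F a 2]) :
    ∃ c : ℂ, c ≠ 0 ∧ ∀ a, F a 2 = c * a 2 := by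
  obtain ⟨⟨f, hf⟩, G, ⟨g, hg⟩, hFG, hGF⟩ := hF
  have key := zpow_mul_eval_eq (g := f 2)
    (fun a => by rw [← hf, ← hf, hc]; rfl) (-1)
    (fun α hα a => by rw [← hf, ← hf, ht α hα]; simp)
  set u : R3 := Polynomial.aeval (p * X 2 ^ 2) (lineRestriction (f 2)) with hu
  have hfu : f 2 = X 2 * u := by
    refine funext_off_zeros X_two_ne_zero fun a ha => ?_
    rw [eval_X] at ha
    rw [map_mul, hu, eval_aeval_p_mul_sq, ← key a ha, eval_X]
    simp [ha]
  have hGeval : ∀ (q : R3) b, eval b (bind₁ g q) = eval (G b) q := by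
    intro q b
    have : G b = fun j => eval b (g j) := funext (hg b)
    rw [this]
    simp only [← aeval_eq_eval, aeval_bind₁]
  have hX : (X 2 : R3) = bind₁ g (X 2) * bind₁ g u := by
    rw [← map_mul, ← hfu]
    refine MvPolynomial.funext fun b => ?_
    rw [hGeval, ← hf, eval_X]
    exact (congrFun (congrFun hFG b) 2).symm
  have hGFa : ∀ a, G (F a) = a := congrFun hGF
  rcases (X_prime (i := (2 : Fin 3)) (R := ℂ)).irreducible.isUnit_or_isUnit hX with h | h
  · obtain ⟨c, -, hc'⟩ := isUnit_iff_eq_C_of_isReduced.1 h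
    have h1 := hGeval (X 2) (F ![0, 0, c + 1])
    rw [hc', hGFa] at h1
    simp at h1
  · obtain ⟨c, hcu, hc'⟩ := isUnit_iff_eq_C_of_isReduced.1 h
    refine ⟨c, hcu.ne_zero, fun a => ?_⟩
    have h1 := hGeval u (F a)
    rw [hc', hGFa, eval_C] at h1
    rw [hf, hfu, map_mul, ← h1, eval_X, mul_comm]

theorem exists_middle_coordinate {F : (Fin 3 → ℂ) → (Fin 3 → ℂ)} (hF : IsPolyMap F)
    (hc : ∀ a, F (h'map a) = h'map (F a))
    (ht : ∀ α : ℂ, α ≠ 0 → ∀ a, F ![α ^ 3 * a 0, α * a 1, α⁻¹ * a 2] =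
      ![α ^ 3 * F a 0, α * F a 1, α⁻¹ * F a 2])
    {c : ℂ} (hc0 : c ≠ 0) (h2 : ∀ a, F a 2 = c * a 2) :
    ∃ W : Polynomial ℂ, ∀ a, F a 1 = c * expMap (pMulPoly W) a 1 := by
  obtain ⟨f, hf⟩ := hF
  set g : R3 := f 1 - C c * X 1 with hgdef
  have hg : ∀ a, eval a g = F a 1 - c * a 1 := fun a => by simp [hgdef, hf]
  have key := zpow_mul_eval_eq (g := g)
    (fun a => by rw [hg, hg, hc]; simp [h'map, h2]; ring) 1
    (fun α hα a => by rw [hg, hg, ht α hα]; simp; ring)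
  set U := lineRestriction g
  have hgU : X 2 * g = Polynomial.aeval (p * X 2 ^ 2) U := by
    refine funext_off_zeros X_two_ne_zero fun a ha => ?_
    rw [eval_X] at ha
    rw [map_mul, eval_aeval_p_mul_sq, ← key a ha, eval_X, zpow_one]
  have hU0 : U.eval 0 = 0 := by
    have := congrArg (eval 0) hgU
    rw [eval_aeval_p_mul_sq] at this
    simpa using this.symm
  obtain ⟨V, hV⟩ := Polynomial.exists_eq_X_mul_of_eval_zero hU0
  have hgV : g = X 2 * pMulPoly V := by
    refine funext_off_zeros X_two_ne_zero fun a ha => ?_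
    rw [eval_X] at ha
    have := congrArg (eval a) hgU
    rw [eval_aeval_p_mul_sq, hV] at this
    rw [map_mul, eval_pMulPoly]
    refine mul_left_cancel₀ ha ?_
    simp only [Polynomial.eval_mul, Polynomial.eval_X, map_mul, eval_X] at this ⊢
    linear_combination this
  refine ⟨Polynomial.C c⁻¹ * V, fun a => ?_⟩
  have h1 := hg a
  rw [hgV, map_mul, eval_X, eval_pMulPoly] at h1
  rw [eq_add_of_sub_eq h1.symm]
  simp [expMap, eval_pMulPoly]
  field_simp
  ring

theorem first_coordinate_eq {F : (Fin 3 → ℂ) → (Fin 3 → ℂ)} (hF : IsPolyMap F)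
    (hinj : Function.Injective F) (hc : ∀ a, F (h'map a) = h'map (F a))
    (ht : ∀ α : ℂ, α ≠ 0 → ∀ a, F ![α ^ 3 * a 0, α * a 1, α⁻¹ * a 2] =
      ![α ^ 3 * F a 0, α * F a 1, α⁻¹ * F a 2])
    {c : ℂ} (hc0 : c ≠ 0) {W : Polynomial ℂ} (h2 : ∀ a, F a 2 = c * a 2)
    (h1 : ∀ a, F a 1 = c * expMap (pMulPoly W) a 1) (a : Fin 3 → ℂ) :
    F a 0 = c * expMap (pMulPoly W) a 0 := by
  obtain ⟨f, hf⟩ := hF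
  obtain ⟨e, he⟩ := isPolyMap_expMap (pMulPoly W)
  set g : R3 := f 0 - C c * e 0 with hgdef
  have hg : ∀ a, eval a g = F a 0 - c * expMap (pMulPoly W) a 0 :=
    fun a => by simp [hgdef, hf, he]
  have key := zpow_mul_eval_eq (g := g)
    (fun a => by
      rw [hg, hg, hc]
      simp only [expMap, eval_h'map_pMulPoly]
      simp [h'map, h1, h2, expMap]
      ring) 3
    (fun α hα a => by
      rw [hg, hg, ht α hα]
      simp only [expMap, eval_torus_pMulPoly W hα]
      simp
      field_simp)
  set U := lineRestriction g
  have hgU : X 2 ^ 3 * g = Polynomial.aeval (p * X 2 ^ 2) U := by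
    refine funext_off_zeros X_two_ne_zero fun a ha => ?_
    rw [eval_X] at ha
    rw [map_mul, eval_aeval_p_mul_sq, ← key a ha, map_pow, eval_X]
    rfl
  have hU0 : U.eval 0 = 0 := by
    have := congrArg (eval 0) hgU
    rw [eval_aeval_p_mul_sq] at this
    simpa using this.symm
  obtain ⟨V, hV⟩ := Polynomial.exists_eq_X_mul_of_eval_zero hU0
  have hgV : X 2 * g = pMulPoly V := by
    refine funext_off_zeros X_two_ne_zero fun a ha => ?_
    rw [eval_X] at ha
    have := congrArg (eval a) hgU
    rw [eval_aeval_p_mul_sq, hV] at this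
    rw [map_mul, eval_pMulPoly]
    refine mul_left_cancel₀ (pow_ne_zero 2 ha) ?_
    simp only [Polynomial.eval_mul, Polynomial.eval_X, map_mul, map_pow, eval_X] at this ⊢
    linear_combination this
  have hV0 : V.eval 0 = 0 := by
    have := congrArg (eval ![0, 1, 0]) hgV
    rw [eval_pMulPoly] at this
    simpa using this.symm
  obtain ⟨S, hS⟩ := Polynomial.exists_eq_X_mul_of_eval_zero hV0
  have hgS : g = X 2 * p * pMulPoly S := by
    refine funext_off_zeros X_two_ne_zero fun a ha => ?_
    rw [eval_X] at ha
    have := congrArg (eval a) hgV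
    rw [eval_pMulPoly, hS] at this
    rw [map_mul, eval_pMulPoly]
    refine mul_left_cancel₀ ha ?_
    simp only [Polynomial.eval_mul, Polynomial.eval_X, map_mul, eval_X, eval_p] at this ⊢
    linear_combination this
  let b : ℂ → Fin 3 → ℂ := fun x => expMap (pMulPoly (-W)) ![x, 0, 1]
  have hb : ∀ x, expMap (pMulPoly W) (b x) = ![x, 0, 1] := fun x => expMap_pMulPoly_neg W _
  have hgb : ∀ x, eval (b x) g = x ^ 2 * S.eval x := by
    intro x
    have hP : eval (b x) p = x := by
      simp [b, eval_p, expMap]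
    rw [hgS, map_mul, map_mul, hP, eval_expMap_pMulPoly, eval_pMulPoly]
    simp [b, expMap]
    ring
  have hFb : ∀ x, F (b x) = ![c * x + x ^ 2 * S.eval x, 0, c] := by
    intro x
    ext i
    fin_cases i
    · have := hg (b x)
      rw [hgb, hb] at this
      simp at this ⊢
      linear_combination -this
    · simp [h1, hb]
    · simp [h2, b, expMap]
  have hS0 : S = 0 := by
    refine Polynomial.eq_zero_of_forall_add_mul_eval_ne_zero (c := c) fun x hx => ?_
    have hF0 : F (b x) = F (b 0) := by
      rw [hFb, hFb]
      congr 1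
      linear_combination x * hx
    have h0 := congrArg (expMap (pMulPoly W)) (hinj hF0)
    rw [hb, hb] at h0
    have hx0 : x = 0 := by simpa using congrFun h0 0
    exact hc0 (by simpa [hx0] using hx)
  have h0 := hg a
  rw [hgS, hS0] at h0
  simp [pMulPoly] at h0
  exact sub_eq_zero.1 h0.symm

/-- H = C ⋉ K consists exactly of the elements of the centralizer of
exp(D) in Aut(ℂ³) that commute with the torus {(α³x, αy, α⁻¹z) : α ∈ ℂ*}. -/
theorem stmt_19 (F : (Fin 3 → ℂ) → (Fin 3 → ℂ)) :
    (∃ c k, c ∈ Cset ∧ k ∈ Kset ∧ F = c ∘ k) ↔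
      (IsPolyAut F ∧ F ∘ h'map = h'map ∘ F ∧
        ∀ α : ℂ, α ≠ 0 →
          F ∘ (fun a : Fin 3 → ℂ => ![α ^ 3 * a 0, α * a 1, α⁻¹ * a 2]) =
            (fun a : Fin 3 → ℂ => ![α ^ 3 * a 0, α * a 1, α⁻¹ * a 2]) ∘ F) := by
  constructor
  · rintro ⟨_, _, ⟨α, hα, rfl⟩, ⟨w, hw, rfl⟩, rfl⟩
    rw [Algebra.adjoin_singleton_eq_range_aeval] at hw
    obtain ⟨W, rfl⟩ := hw
    refine ⟨isPolyAut_smul_comp_expMap hα W, funext fun a => ?_, fun β hβ => funext fun a => ?_⟩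
    · have h := eval_h'map_pMulPoly W a
      rw [pMulPoly] at h
      simp only [Function.comp_apply, expMap]
      erw [h]
      ext i; fin_cases i <;> simp [h'map] <;> ring
    · have h := eval_torus_pMulPoly W hβ a
      rw [pMulPoly] at h
      simp only [Function.comp_apply, expMap]
      erw [h]
      ext i; fin_cases i <;> simp <;> field_simp
  · rintro ⟨hF, hc, ht⟩
    replace hc : ∀ a, F (h'map a) = h'map (F a) := congrFun hc
    replace ht : ∀ α : ℂ, α ≠ 0 → ∀ a, F ![α ^ 3 * a 0, α * a 1, α⁻¹ * a 2] =
        ![α ^ 3 * F a 0, α * F a 1, α⁻¹ * F a 2] := fun α hα => congrFun (ht α hα)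
    obtain ⟨c, hc0, h2⟩ := exists_last_coordinate hF hc ht
    obtain ⟨W, h1⟩ := exists_middle_coordinate hF.1 hc ht hc0 h2
    have hinj : Function.Injective F := by
      obtain ⟨-, G, -, -, hGF⟩ := hF
      exact Function.LeftInverse.injective (g := G) (congrFun hGF)
    have h0 := first_coordinate_eq hF.1 hinj hc ht hc0 h2 h1
    refine ⟨_, _, ⟨c, hc0, rfl⟩, ⟨Polynomial.aeval (p * X 2 ^ 2) W, ?_, rfl⟩, funext fun a => ?_⟩
    · rw [Algebra.adjoin_singleton_eq_range_aeval]
      exact ⟨W, rfl⟩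
    · ext i
      fin_cases i
      · exact h0 a
      · exact h1 a
      · exact h2 a
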